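/- Let R be a commutative Noetherian ring, let M be a finitely generated R-module, and let n be a natural number. Then the set of prime ideals p of R such that the R_p-module M_p has projective dimension at most n is an open subset of Spec R with its Zariski topology. -/

import Mathlib

open CategoryTheory Limits

universe u

/-- An object `X` of an abelian category with enough projectives has projective dimension
at most `n` if it admits a projective resolution `P` whose components vanish in
degrees `> n`. -/
def HasProjDimLE {C : Type*} [Category C] [Abelian C] (X : C) (n : ℕ) : Prop :=
  ∃ P : ProjectiveResolution X, ∀ k : ℕ, n < k → IsZero (P.complex.X k)

section Aux

lemma aux_forward {C : Type*} [Category C] [Abelian C] (K : ChainComplex C ℕ)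
    (hP : ∀ k, Projective (K.X k))
    (hex : ∀ k, (ShortComplex.mk _ _ (K.d_comp_d (k + 2) (k + 1) k)).Exact)
    (n : ℕ) (hz : IsZero (K.X (n + 1))) :
    ∀ (m k : ℕ), n = k + m → ∀ (Y : C) (f : K.X k ⟶ Y) (w : K.d (k + 1) k ≫ f = 0),
      (ShortComplex.mk _ _ w).Exact → Epi f → HasProjectiveDimensionLE Y m := by
  intro m
  induction m with
  | zero =>
    intro k hk Y f w hE _
    obtain rfl : n = k := hk
    have hm : Mono f := (ShortComplex.exact_iff_mono _ (hz.eq_of_src _ _)).1 hE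
    have : IsIso f := isIso_of_mono_of_epi f
    have := hP n
    have : Projective Y := Projective.of_iso (asIso f) this
    exact (projective_iff_hasProjectiveDimensionLE_zero _).1 this
  | succ m ih =>
    intro k hk Y f w hE _
    let T := ShortComplex.mk (kernel.ι f) f (kernel.condition f)
    have T_exact : T.ShortExact := { exact := ShortComplex.exact_kernel f }
    have hp : Projective T.X₂ := hP k
    have he : Epi (kernel.lift f _ w) := (ShortComplex.exact_iff_epi_kernel_lift _).1 hE
    have hw : K.d (k + 2) (k + 1) ≫ kernel.lift f _ w = 0 := by
      rw [← cancel_mono (kernel.ι f)]; simp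
    refine (T_exact.hasProjectiveDimensionLT_X₃_iff m hp).mpr
      (ih (k + 1) (by omega) (kernel f) (kernel.lift f _ w) hw ?_ he)
    let α : ShortComplex.mk _ _ hw ⟶ ShortComplex.mk _ _ (K.d_comp_d (k + 2) (k + 1) k) :=
      { τ₁ := 𝟙 _
        τ₂ := 𝟙 _
        τ₃ := kernel.ι f }
    have : Epi α.τ₁ := by dsimp [α]; infer_instance
    have : IsIso α.τ₂ := by dsimp [α]; infer_instance
    have : Mono α.τ₃ := by dsimp [α]; infer_instance
    exact (ShortComplex.exact_iff_of_epi_of_isIso_of_mono α).2 (hex k)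

lemma aux_succ {C : Type*} [Category C] [Abelian C] {X P : C} [Projective P]
    (p : P ⟶ X) [Epi p] (n : ℕ) (h : HasProjDimLE (kernel p) n) : HasProjDimLE X (n + 1) := by
  obtain ⟨Q, hQ⟩ := h
  let q : Q.complex.X 0 ⟶ kernel p := Q.π.f 0
  have hq : Q.complex.d 1 0 ≫ q = 0 := Q.complex_d_comp_π_f_zero
  have hqe : Epi q := inferInstanceAs (Epi (Q.π.f 0))
  have hqx : (ShortComplex.mk _ _ hq).Exact := Q.exact₀
  have hq2 : Q.complex.d 1 0 ≫ q ≫ kernel.ι p = 0 := by rw [reassoc_of% hq, zero_comp]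
  let K := ChainComplex.augment Q.complex (q ≫ kernel.ι p) hq2
  have hK0 : K.d 1 0 ≫ p = 0 := by
    change (q ≫ kernel.ι p) ≫ p = 0
    simp
  have hex0 : (ShortComplex.mk _ _ hK0).Exact := by
    let α : ShortComplex.mk _ _ hK0 ⟶ ShortComplex.mk _ _ (kernel.condition p) :=
      { τ₁ := q
        τ₂ := 𝟙 _
        τ₃ := 𝟙 _
        comm₁₂ := by
          change q ≫ kernel.ι p = (q ≫ kernel.ι p) ≫ 𝟙 _
          simp
        comm₂₃ := by
          change 𝟙 _ ≫ p = p ≫ 𝟙 _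
          simp }
    have : Epi α.τ₁ := hqe
    have : IsIso α.τ₂ := inferInstanceAs (IsIso (𝟙 P))
    have : Mono α.τ₃ := by dsimp [α]; infer_instance
    exact (ShortComplex.exact_iff_of_epi_of_isIso_of_mono α).2 (ShortComplex.exact_kernel p)
  have hex1 : (ShortComplex.mk _ _ (K.d_comp_d 2 1 0)).Exact := by
    let α : ShortComplex.mk _ _ hq ⟶ ShortComplex.mk _ _ (K.d_comp_d 2 1 0) :=
      { τ₁ := 𝟙 _
        τ₂ := 𝟙 _
        τ₃ := kernel.ι p
        comm₁₂ := by
          change 𝟙 _ ≫ Q.complex.d 1 0 = Q.complex.d 1 0 ≫ 𝟙 _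
          simp
        comm₂₃ := by
          change 𝟙 _ ≫ q ≫ kernel.ι p = q ≫ kernel.ι p
          simp }
    have : Epi α.τ₁ := by dsimp only [α]; exact inferInstanceAs (Epi (𝟙 (Q.complex.X 1)))
    have : IsIso α.τ₂ := by dsimp only [α]; exact inferInstanceAs (IsIso (𝟙 (Q.complex.X 0)))
    have : Mono α.τ₃ := inferInstanceAs (Mono (kernel.ι p))
    exact (ShortComplex.exact_iff_of_epi_of_isIso_of_mono α).1 hqx
  have hex2 (k : ℕ) : (ShortComplex.mk _ _ (K.d_comp_d (k + 3) (k + 2) (k + 1))).Exact :=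
    Q.exact_succ k
  refine ⟨{ complex := K
            projective := ?_
            π := (ChainComplex.toSingle₀Equiv _ _).symm ⟨p, hK0⟩
            quasiIso := ⟨fun n => ?_⟩ }, ?_⟩
  · rintro (_ | k)
    · exact inferInstanceAs (Projective P)
    · exact Q.projective k
  · cases n with
    | zero =>
      rw [ChainComplex.quasiIsoAt₀_iff, ShortComplex.quasiIso_iff_of_zeros']
      · refine (ShortComplex.exact_and_epi_g_iff_of_iso ?_).2 ⟨hex0, ‹Epi p›⟩
        exact ShortComplex.isoMk (Iso.refl _) (Iso.refl _) (Iso.refl _)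
          ((Category.id_comp _).trans (Category.comp_id _).symm)
          (by
            refine (Category.id_comp _).trans (Eq.trans ?_ (Category.comp_id _).symm)
            exact (ChainComplex.toSingle₀Equiv_symm_apply_f_zero (C := K) p hK0).symm)
      all_goals rfl
    | succ k =>
      rw [quasiIsoAt_iff_exactAt']
      · rw [HomologicalComplex.exactAt_iff' _ (k + 1 + 1) (k + 1) k (by simp) (by simp)]
        cases k with
        | zero => exact hex1
        | succ k => exact hex2 k
      · apply ChainComplex.exactAt_succ_single_obj
  · rintro (_ | k) hk
    · omega
    · exact hQ k (by omega)

lemma hasProjDimLE_iff {C : Type*} [Category C] [Abelian C] [EnoughProjectives C]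
    (X : C) (n : ℕ) : HasProjDimLE X n ↔ HasProjectiveDimensionLE X n := by
  constructor
  · rintro ⟨P, hP⟩
    exact aux_forward P.complex P.projective P.exact_succ n (hP _ (by omega)) n 0 (by omega) X
      (P.π.f 0) P.complex_d_comp_π_f_zero P.exact₀ (inferInstanceAs (Epi (P.π.f 0)))
  · induction n generalizing X with
    | zero =>
      intro h
      have : Projective X := (projective_iff_hasProjectiveDimensionLE_zero _).2 h
      refine ⟨ProjectiveResolution.self X, fun k hk => ?_⟩
      exact HomologicalComplex.isZero_single_obj_X _ _ _ _ (by omega)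
    | succ n ih =>
      intro h
      let T := ShortComplex.mk (kernel.ι (Projective.π X)) (Projective.π X) (kernel.condition _)
      have T_exact : T.ShortExact := { exact := ShortComplex.exact_kernel _ }
      exact aux_succ (Projective.π X) n (ih _ ((T_exact.hasProjectiveDimensionLT_X₃_iff n
        (inferInstanceAs (Projective (Projective.over X)))).mp h))

lemma isOpen_aux (R : Type u) [CommRing R] [IsNoetherianRing R] (n : ℕ)
    (M : ModuleCat.{u} R) [Module.Finite R M] :
    IsOpen {p : PrimeSpectrum R |
      HasProjectiveDimensionLE (M.localizedModule p.asIdeal.primeCompl) n} := by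
  induction n generalizing M with
  | zero =>
    have : Module.FinitePresentation R M := Module.finitePresentation_of_finite R M
    convert Module.isOpen_freeLocus (R := R) (M := M) using 1
    ext p
    rw [Module.mem_freeLocus_of_isLocalization p (Localization.AtPrime p.asIdeal)
      (M.localizedModule p.asIdeal.primeCompl)
      (M.localizedModuleMkLinearMap p.asIdeal.primeCompl)]
    rw [Set.mem_ofPred_eq, ← projective_iff_hasProjectiveDimensionLE_zero,
      ← IsProjective.iff_projective]
    have : Module.Finite (Localization.AtPrime p.asIdeal)
        (M.localizedModule p.asIdeal.primeCompl) :=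
      Module.Finite.of_isLocalizedModule p.asIdeal.primeCompl
        (M.localizedModuleMkLinearMap p.asIdeal.primeCompl)
    exact ⟨fun h => Module.free_of_flat_of_isLocalRing, fun h => Module.Projective.of_free⟩
  | succ n ih =>
    rcases Module.exists_finite_presentation R M with ⟨P, _, _, _, _, f, surjf⟩
    let S := f.shortComplexKer
    have S_exact := LinearMap.shortExact_shortComplexKer surjf
    have proj := ModuleCat.projective_of_categoryTheory_projective S.X₂
    let Sp (p : PrimeSpectrum R) := S.map (ModuleCat.localizedModuleFunctor p.1.primeCompl)
    have Sp_exact (p : PrimeSpectrum R) : (Sp p).ShortExact :=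
      S_exact.map_of_exact (ModuleCat.localizedModuleFunctor p.asIdeal.primeCompl)
    have projp (p : PrimeSpectrum R) : Projective (Sp p).X₂ :=
      (ModuleCat.localizedModuleFunctor.{u} p.1.primeCompl).projective_obj_of_projective proj
    convert ih (ModuleCat.of R (LinearMap.ker f)) using 1
    ext p
    exact (Sp_exact p).hasProjectiveDimensionLT_X₃_iff n (projp p)

end Aux

/-- Let `R` be a commutative Noetherian ring, `M` a finitely generated
`R`-module, and `n : ℕ`. Then the set of primes `p` such that the `R_p`-module `M_p`
has projective dimension at most `n` is open in `Spec R`. -/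
theorem isOpen_projDim_le_locus (R : Type u) [CommRing R] [IsNoetherianRing R]
    (M : Type u) [AddCommGroup M] [Module R M] [Module.Finite R M] (n : ℕ) :
    IsOpen {p : PrimeSpectrum R |
      HasProjDimLE (ModuleCat.of (Localization.AtPrime p.asIdeal)
        (LocalizedModule p.asIdeal.primeCompl M)) n} := by
  convert isOpen_aux R n (ModuleCat.of R M) using 1
  ext p
  rw [Set.mem_ofPred_eq, Set.mem_ofPred_eq, hasProjDimLE_iff]
  let e : (ModuleCat.of R M).localizedModule p.asIdeal.primeCompl
      ≃ₗ[Localization.AtPrime p.asIdeal]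
      ModuleCat.of (Localization.AtPrime p.asIdeal) (LocalizedModule p.asIdeal.primeCompl M) :=
    Shrink.linearEquiv.{u} (Localization.AtPrime p.asIdeal) _
  exact ⟨fun h => ModuleCat.hasProjectiveDimensionLE_of_linearEquiv e.symm n,
    fun h => ModuleCat.hasProjectiveDimensionLE_of_linearEquiv e n⟩
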